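/- Let S be a normal affine semigroup, i.e., S = C ∩ ℤ^n for a pointed rational polyhedral cone C ⊆ ℝ^n, with grading deg making each S_r finite, and let H_S(t) be its Hilbert series. If the semigroup ring ℂ[S] is Gorenstein, then H_S(t) = (-1)^d t^a H_S(1/t) for some integer a, where d = dim C. -/

import Mathlib

open PowerSeries

/-- `F'` is the rational function `(-1) ^ n * F(1/t)`, where `F` is a rational power series. -/
def IsReciprocal (n : ℕ) (F F' : PowerSeries ℚ) : Prop :=
  ∃ p p' q : Polynomial ℚ, q ≠ 0 ∧ F * (q : PowerSeries ℚ) = p ∧ F' * (q : PowerSeries ℚ) = p' ∧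
    (algebraMap (Polynomial ℚ) (RatFunc ℚ) p') / (algebraMap (Polynomial ℚ) (RatFunc ℚ) q)
      = (-1 : RatFunc ℚ) ^ n *
        ((p.eval₂ (algebraMap ℚ (RatFunc ℚ)) (RatFunc.X)⁻¹) /
         (q.eval₂ (algebraMap ℚ (RatFunc ℚ)) (RatFunc.X)⁻¹))

lemma RatFunc.eval₂_inv_X_ne_zero {q : Polynomial ℚ} (hq : q ≠ 0) :
    q.eval₂ (algebraMap ℚ (RatFunc ℚ)) (RatFunc.X)⁻¹ ≠ 0 := by
  have h : Transcendental ℚ (RatFunc.X : RatFunc ℚ)⁻¹ := by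
    intro h
    refine RatFunc.transcendental_X (K := ℚ) ?_
    have h' := h.inv
    rw [inv_inv] at h'
    convert h'
    exact Subsingleton.elim _ _
  intro h0
  exact hq ((transcendental_iff.mp h) q h0)

lemma IsReciprocal.zero (n : ℕ) : IsReciprocal n 0 0 :=
  ⟨0, 0, 1, one_ne_zero, by simp, by simp, by simp⟩

lemma IsReciprocal.add {n : ℕ} {F F' G G' : PowerSeries ℚ} (hF : IsReciprocal n F F')
    (hG : IsReciprocal n G G') : IsReciprocal n (F + G) (F' + G') := by
  obtain ⟨p₁, p₁', q₁, hq₁, h₁, h₁', e₁⟩ := hF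
  obtain ⟨p₂, p₂', q₂, hq₂, h₂, h₂', e₂⟩ := hG
  refine ⟨p₁ * q₂ + p₂ * q₁, p₁' * q₂ + p₂' * q₁, q₁ * q₂, mul_ne_zero hq₁ hq₂, ?_, ?_, ?_⟩
  · simp only [Polynomial.coe_add, Polynomial.coe_mul, ← h₁, ← h₂]; ring
  · simp only [Polynomial.coe_add, Polynomial.coe_mul, ← h₁', ← h₂']; ring
  · have a₁ := RatFunc.algebraMap_ne_zero hq₁
    have a₂ := RatFunc.algebraMap_ne_zero hq₂
    have b₁ := RatFunc.eval₂_inv_X_ne_zero hq₁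
    have b₂ := RatFunc.eval₂_inv_X_ne_zero hq₂
    simp only [map_add, map_mul, Polynomial.eval₂_add, Polynomial.eval₂_mul]
    rw [add_div, mul_div_mul_right _ _ a₂, mul_comm (algebraMap _ (RatFunc ℚ) q₁),
      mul_div_mul_right _ _ a₁, e₁, e₂, ← mul_add, div_add_div _ _ b₁ b₂,
      mul_comm (Polynomial.eval₂ _ _ q₁) (Polynomial.eval₂ _ _ p₂)]

lemma IsReciprocal.sum {ι : Type*} {n : ℕ} (s : Finset ι) {F F' : ι → PowerSeries ℚ}
    (h : ∀ i ∈ s, IsReciprocal n (F i) (F' i)) :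
    IsReciprocal n (∑ i ∈ s, F i) (∑ i ∈ s, F' i) := by
  classical
  induction s using Finset.induction_on with
  | empty => simpa using IsReciprocal.zero n
  | insert i s hi ih =>
    rw [Finset.sum_insert hi, Finset.sum_insert hi]
    exact (h i (by simp)).add (ih fun j hj => h j (by simp [hj]))

lemma IsReciprocal.of_mul_prod {ι α : Type*} (B : Finset ι) (d : ι → ℕ)
    (hd : ∀ i ∈ B, d i ≠ 0) (P : Finset α) (e : α → ℕ) (he : ∀ x ∈ P, e x ≤ ∑ i ∈ B, d i)
    {F F' : PowerSeries ℚ}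
    (hF : F * ∏ i ∈ B, (1 - PowerSeries.X ^ d i) = ∑ x ∈ P, PowerSeries.X ^ e x)
    (hF' : F' * ∏ i ∈ B, (1 - PowerSeries.X ^ d i) =
      ∑ x ∈ P, PowerSeries.X ^ (∑ i ∈ B, d i - e x)) :
    IsReciprocal B.card F F' := by
  have hcoe : ∀ s : Finset α, ∀ f : α → ℕ, ((∑ x ∈ s, Polynomial.X ^ f x : Polynomial ℚ) :
      PowerSeries ℚ) = ∑ x ∈ s, PowerSeries.X ^ f x := by
    intro s f
    rw [← Polynomial.coeToPowerSeries.ringHom_apply, map_sum]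
    simp
  have hcoe' : ((∏ i ∈ B, (1 - Polynomial.X ^ d i) : Polynomial ℚ) : PowerSeries ℚ) =
      ∏ i ∈ B, (1 - PowerSeries.X ^ d i) := by
    rw [← Polynomial.coeToPowerSeries.ringHom_apply, map_prod]
    simp
  have hq : (∏ i ∈ B, (1 - Polynomial.X ^ d i) : Polynomial ℚ) ≠ 0 := by
    refine Finset.prod_ne_zero_iff.mpr fun i hi h => ?_
    have := congrArg (Polynomial.eval 0) h
    simp [hd i hi] at this
  refine ⟨∑ x ∈ P, Polynomial.X ^ e x, ∑ x ∈ P, Polynomial.X ^ (∑ i ∈ B, d i - e x),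
    ∏ i ∈ B, (1 - Polynomial.X ^ d i), hq, ?_, ?_, ?_⟩
  · rw [hcoe, hcoe', hF]
  · rw [hcoe, hcoe', hF']
  · have hX : (RatFunc.X : RatFunc ℚ) ≠ 0 := RatFunc.X_ne_zero
    have hA := RatFunc.algebraMap_ne_zero hq
    set D := ∑ i ∈ B, d i with hD
    have h1 : algebraMap (Polynomial ℚ) (RatFunc ℚ) (∑ x ∈ P, Polynomial.X ^ (D - e x)) =
        RatFunc.X ^ D * (∑ x ∈ P, Polynomial.X ^ e x : Polynomial ℚ).eval₂
          (algebraMap ℚ (RatFunc ℚ)) (RatFunc.X)⁻¹ := by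
      rw [Polynomial.eval₂_finsetSum, map_sum, Finset.mul_sum]
      refine Finset.sum_congr rfl fun x hx => ?_
      rw [map_pow, RatFunc.algebraMap_X, Polynomial.eval₂_pow, Polynomial.eval₂_X,
        pow_sub₀ _ hX (he x hx), inv_pow]
    have h2 : (∏ i ∈ B, (1 - Polynomial.X ^ d i) : Polynomial ℚ).eval₂
          (algebraMap ℚ (RatFunc ℚ)) (RatFunc.X)⁻¹ * RatFunc.X ^ D =
        (-1) ^ B.card * algebraMap (Polynomial ℚ) (RatFunc ℚ)
          (∏ i ∈ B, (1 - Polynomial.X ^ d i)) := by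
      rw [Polynomial.eval₂_finsetProd, map_prod, hD, ← Finset.prod_pow_eq_pow_sum,
        ← Finset.prod_const, ← Finset.prod_mul_distrib, ← Finset.prod_mul_distrib]
      refine Finset.prod_congr rfl fun i _ => ?_
      simp only [Polynomial.eval₂_sub, Polynomial.eval₂_one, Polynomial.eval₂_pow,
        Polynomial.eval₂_X, map_sub, map_one, map_pow, RatFunc.algebraMap_X, inv_pow]
      field_simp
      ring
    have hB := RatFunc.eval₂_inv_X_ne_zero hq
    rw [h1, ← mul_div_assoc, div_eq_div_iff hA hB]
    linear_combination (Polynomial.eval₂ (algebraMap ℚ (RatFunc ℚ)) RatFunc.X⁻¹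
      (∑ x ∈ P, Polynomial.X ^ e x)) * h2

section HilbertSeries

variable {M : Type*}

/-- The Hilbert series of a set of elements of a graded semigroup. -/
noncomputable def hilbertSeries (deg : M → ℕ) (A : Set M) : PowerSeries ℚ :=
  PowerSeries.mk fun r => ({x ∈ A | deg x = r}.ncard : ℚ)

lemma hilbertSeries_union {deg : M → ℕ} {A B : Set M}
    (hA : ∀ r, {x ∈ A | deg x = r}.Finite) (hB : ∀ r, {x ∈ B | deg x = r}.Finite)
    (hAB : Disjoint A B) :
    hilbertSeries deg (A ∪ B) = hilbertSeries deg A + hilbertSeries deg B := by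
  ext r
  simp only [hilbertSeries, PowerSeries.coeff_mk, map_add]
  rw [← Nat.cast_add, ← Set.ncard_union_eq _ (hA r) (hB r)]
  · congr 2; ext x; simp [or_and_right]
  · exact hAB.mono (Set.sep_subset _ _) (Set.sep_subset _ _)

lemma hilbertSeries_biUnion {ι : Type*} {deg : M → ℕ} (s : Finset ι) {A : ι → Set M}
    (hA : ∀ i ∈ s, ∀ r, {x ∈ A i | deg x = r}.Finite)
    (hd : (s : Set ι).PairwiseDisjoint A) :
    hilbertSeries deg (⋃ i ∈ s, A i) = ∑ i ∈ s, hilbertSeries deg (A i) := by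
  classical
  induction s using Finset.induction_on with
  | empty => ext r; simp [hilbertSeries]
  | insert i s hi ih =>
    rw [Finset.sum_insert hi, Finset.set_biUnion_insert, hilbertSeries_union, ih]
    · exact fun j hj => hA j (by simp [hj])
    · exact hd.subset (by simp)
    · exact hA i (by simp)
    · intro r
      refine (s.finite_toSet.biUnion fun j hj => hA j (by simp [Finset.mem_coe.mp hj]) r).subset ?_
      rintro x ⟨hx, hr⟩
      simp only [Set.mem_iUnion] at hx ⊢
      obtain ⟨j, hj, hx⟩ := hx
      exact ⟨j, hj, hx, hr⟩
    · refine Set.disjoint_iUnion₂_right.mpr fun j hj => hd (by simp) (by simp [hj]) ?_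
      rintro rfl; exact hi hj

lemma hilbertSeries_finset (deg : M → ℕ) (P : Finset M) :
    hilbertSeries deg (P : Set M) = ∑ x ∈ P, PowerSeries.X ^ deg x := by
  classical
  ext r
  simp only [hilbertSeries, PowerSeries.coeff_mk, map_sum, PowerSeries.coeff_X_pow]
  rw [Finset.sum_boole]
  have : {x | x ∈ (P : Set M) ∧ deg x = r} = ((P.filter fun x => r = deg x : Finset M) : Set M) := by
    ext x; simp [eq_comm]
  rw [this, Set.ncard_coe_finset]

lemma hilbertSeries_image_add [AddCommGroup M] {deg : M → ℕ} {A : Set M} {c : M}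
    (h : ∀ a ∈ A, deg (c + a) = deg c + deg a) :
    hilbertSeries deg ((fun s => c + s) '' A) = PowerSeries.X ^ deg c * hilbertSeries deg A := by
  ext r
  rw [PowerSeries.coeff_X_pow_mul']
  simp only [hilbertSeries, PowerSeries.coeff_mk]
  split_ifs with hr
  · congr 1
    rw [← Set.ncard_image_of_injective {x | x ∈ A ∧ deg x = r - deg c} (add_right_injective c)]
    congr 1
    ext x
    simp only [Set.mem_ofPred_eq, Set.mem_image]
    constructor
    · rintro ⟨⟨a, ha, rfl⟩, hx⟩
      exact ⟨a, ⟨ha, by have := h a ha; omega⟩, rfl⟩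
    · rintro ⟨a, ⟨ha, hx⟩, rfl⟩
      exact ⟨⟨a, ha, rfl⟩, by have := h a ha; omega⟩
  · rw [Nat.cast_eq_zero]
    convert Set.ncard_empty M
    rw [Set.eq_empty_iff_forall_notMem]
    rintro x ⟨hx, hxr⟩
    obtain ⟨a, ha, rfl⟩ := (Set.mem_image _ _ _).mp hx
    have := h a ha
    omega

end HilbertSeries

section SimplicialCell

variable {ι M : Type*} [AddCommGroup M]

/-- `t + ε * w` is positive for all small positive `ε`. -/
def LexPos (w t : ℝ) : Prop := 0 < t ∨ (t = 0 ∧ 0 < w)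

lemma LexPos.nonneg {w t : ℝ} (h : LexPos w t) : 0 ≤ t := by
  rcases h with h | h
  · exact h.le
  · exact h.1.ge

lemma LexPos.of_sub_one {w t : ℝ} (h : LexPos w (t - 1)) : LexPos w t :=
  Or.inl (by linarith [h.nonneg])

lemma lexPos_neg_one_sub {w t : ℝ} (hw : w ≠ 0) :
    LexPos (-w) (1 - t) ↔ ¬ LexPos w (t - 1) := by
  unfold LexPos
  rcases lt_trichotomy t 1 with h | rfl | h
  · simp [h, h.le, h.ne, sub_eq_zero]
  · simp [hw.le_iff_lt]
  · have h1 : ¬ (1 - t = 0) := by linarith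
    simp [h, h.le, h1]

/-- The half-open simplicial cone in the coordinates `b` selected by the direction `w`. -/
def halfOpenCell (B : Finset ι) (b : ι → M →+ ℝ) (w : ι → ℝ) : Set M :=
  {x | ∀ i ∈ B, LexPos (w i) (b i x)}

/-- The part of a half-open simplicial cone of width one in the directions in `J`. -/
def halfOpenBox (B : Finset ι) (b : ι → M →+ ℝ) (w : ι → ℝ) (J : Finset ι) : Set M :=
  {x | ∀ i ∈ B, LexPos (w i) (b i x) ∧ (i ∈ J → ¬ LexPos (w i) (b i x - 1))}

variable [DecidableEq ι] {S : AddSubmonoid M} {deg : M → ℕ}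
  (hadd : ∀ a ∈ S, ∀ b ∈ S, deg (a + b) = deg a + deg b)
  (hzero : ∀ a ∈ S, (deg a = 0 ↔ a = 0))
  (hfin : ∀ r : ℕ, {a | a ∈ S ∧ deg a = r}.Finite)
  {B : Finset ι} {g : ι → M} {b : ι → M →+ ℝ}
  (hb : ∀ i ∈ B, ∀ j ∈ B, b j (g i) = if i = j then 1 else 0)
  (hS : ∀ x, (∀ i ∈ B, 0 ≤ b i x) → x ∈ S)

include hb in
lemma halfOpenBox_eq_union {w : ι → ℝ} {J : Finset ι} {i : ι} (hi : i ∈ B) (hiJ : i ∉ J) :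
    halfOpenBox B b w J =
      halfOpenBox B b w (insert i J) ∪ (fun x => g i + x) '' halfOpenBox B b w J := by
  have hmem : ∀ x, x ∈ (fun x => g i + x) '' halfOpenBox B b w J ↔
      x ∈ halfOpenBox B b w J ∧ LexPos (w i) (b i x - 1) := by
    intro x
    have hbi : b i (-g i + x) = b i x - 1 := by
      rw [map_add, map_neg, hb i hi i hi, if_pos rfl]; ring
    have hbj : ∀ j ∈ B, i ≠ j → b j (-g i + x) = b j x := by
      intro j hj hij
      rw [map_add, map_neg, hb i hi j hj, if_neg hij]; ring
    rw [Set.image_add_left]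
    constructor
    · intro h
      have hx := (h i hi).1
      rw [hbi] at hx
      refine ⟨fun j hj => ?_, hx⟩
      by_cases hij : i = j
      · subst hij
        exact ⟨hx.of_sub_one, fun h => absurd h hiJ⟩
      · rw [← hbj j hj hij]; exact h j hj
    · rintro ⟨h, hx⟩ j hj
      by_cases hij : i = j
      · subst hij
        rw [hbi]
        exact ⟨hx, fun h => absurd h hiJ⟩
      · rw [hbj j hj hij]; exact h j hj
  ext x
  rw [Set.mem_union, hmem]
  constructor
  · intro h
    by_cases hx : LexPos (w i) (b i x - 1)
    · exact Or.inr ⟨h, hx⟩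
    · refine Or.inl fun j hj => ⟨(h j hj).1, fun hjJ => ?_⟩
      rcases Finset.mem_insert.mp hjJ with rfl | hjJ
      · exact hx
      · exact (h j hj).2 hjJ
  · rintro (h | h)
    · exact fun j hj => ⟨(h j hj).1, fun hjJ => (h j hj).2 (Finset.mem_insert_of_mem hjJ)⟩
    · exact h.1

include hb in
lemma disjoint_halfOpenBox {w : ι → ℝ} {J : Finset ι} {i : ι} (hi : i ∈ B) :
    Disjoint (halfOpenBox B b w (insert i J))
      ((fun x => g i + x) '' halfOpenBox B b w J) := by
  rw [Set.disjoint_right]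
  rintro _ ⟨x, hx, rfl⟩ h
  refine (h i hi).2 (Finset.mem_insert_self _ _) ?_
  have : b i (g i + x) - 1 = b i x := by
    rw [map_add, hb i hi i hi, if_pos rfl]; ring
  simp only [this]
  exact (hx i hi).1

omit [DecidableEq ι] in
include hS in
lemma halfOpenBox_subset (w : ι → ℝ) (J : Finset ι) : halfOpenBox B b w J ⊆ S :=
  fun x hx => hS x fun i hi => (hx i hi).1.nonneg

include hb hS in
lemma generator_mem {i : ι} (hi : i ∈ B) : g i ∈ S := by
  refine hS _ fun j hj => ?_
  rw [hb i hi j hj]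
  split_ifs <;> norm_num

include hadd hfin hb hS in
lemma hilbertSeries_halfOpenCell_mul_prod (w : ι → ℝ) (J : Finset ι) (hJ : J ⊆ B) :
    hilbertSeries deg (halfOpenCell B b w) * ∏ i ∈ J, (1 - PowerSeries.X ^ deg (g i)) =
      hilbertSeries deg (halfOpenBox B b w J) := by
  induction J using Finset.induction_on with
  | empty =>
    simp [halfOpenCell, halfOpenBox]
  | insert i J hi ih =>
    have hiB : i ∈ B := hJ (Finset.mem_insert_self _ _)
    have hg := generator_mem hb hS hiB
    have hsub := halfOpenBox_subset hS w J
    rw [Finset.prod_insert hi, mul_left_comm, ih fun j hj => hJ (Finset.mem_insert_of_mem hj),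
      one_sub_mul, ← hilbertSeries_image_add fun a ha => hadd _ hg _ (hsub ha), sub_eq_iff_eq_add,
      ← hilbertSeries_union _ _ (disjoint_halfOpenBox hb hiB), ← halfOpenBox_eq_union hb hiB hi]
    · exact fun r => (hfin r).subset fun x hx => ⟨halfOpenBox_subset hS w _ hx.1, hx.2⟩
    · refine fun r => (hfin r).subset ?_
      rintro x ⟨hx, hr⟩
      obtain ⟨y, hy, rfl⟩ := (Set.mem_image _ _ _).mp hx
      exact ⟨S.add_mem hg (hsub hy), hr⟩

include hb in
lemma sum_sub_mem_halfOpenBox {w : ι → ℝ} (hw : ∀ i ∈ B, w i ≠ 0) {x : M}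
    (hx : x ∈ halfOpenBox B b w B) : ∑ i ∈ B, g i - x ∈ halfOpenBox B b (-w) B := by
  intro j hj
  have h1 : b j (∑ i ∈ B, g i - x) = 1 - b j x := by
    rw [map_sub, map_sum, Finset.sum_congr rfl fun i hi => hb i hi j hj]
    simp [hj]
  have h2 : 1 - b j x - 1 = -(b j x) := by ring
  obtain ⟨h3, h4⟩ := hx j hj
  rw [h1, Pi.neg_apply, lexPos_neg_one_sub (hw j hj)]
  refine ⟨h4 hj, fun _ h5 => ?_⟩
  rw [h2] at h5
  unfold LexPos at h3 h5
  rcases h3 with h3 | h3 <;> rcases h5 with h5 | h5 <;> linarith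

include hadd hzero hfin hb hS in
lemma isReciprocal_halfOpenCell {w : ι → ℝ} (hw : ∀ i ∈ B, w i ≠ 0) :
    IsReciprocal B.card (hilbertSeries deg (halfOpenCell B b w))
      (hilbertSeries deg (halfOpenCell B b (-w))) := by
  classical
  have hw' : ∀ i ∈ B, (-w) i ≠ 0 := fun i hi => neg_ne_zero.mpr (hw i hi)
  have hdeg0 : deg 0 = 0 := (hzero 0 S.zero_mem).mpr rfl
  have hsum : ∀ J ⊆ B, ∑ i ∈ J, g i ∈ S ∧ deg (∑ i ∈ J, g i) = ∑ i ∈ J, deg (g i) := by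
    intro J hJ
    have hmem : ∀ i ∈ J, g i ∈ S := fun i hi => generator_mem hb hS (hJ hi)
    clear hJ
    induction J using Finset.induction_on with
    | empty => simpa using hdeg0
    | insert i J hi ih =>
      obtain ⟨h1, h2⟩ := ih fun j hj => hmem j (by simp [hj])
      have hgi := hmem i (by simp)
      rw [Finset.sum_insert hi, Finset.sum_insert hi, hadd _ hgi _ h1, h2]
      exact ⟨S.add_mem hgi h1, rfl⟩
  have hdeg : ∀ x ∈ halfOpenBox B b w B,
      deg x + deg (∑ i ∈ B, g i - x) = ∑ i ∈ B, deg (g i) := by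
    intro x hx
    rw [← (hsum B subset_rfl).2, ← hadd _ (halfOpenBox_subset hS _ _ hx) _
      (halfOpenBox_subset hS _ _ (sum_sub_mem_halfOpenBox hb hw hx)), add_sub_cancel]
  have hboxfin : (halfOpenBox B b w B).Finite := by
    refine ((Finset.range (∑ i ∈ B, deg (g i) + 1)).finite_toSet.biUnion
      fun r _ => hfin r).subset fun x hx => ?_
    simp only [Set.mem_iUnion]
    have := hdeg x hx
    exact ⟨deg x, by simp; omega, halfOpenBox_subset hS _ _ hx, rfl⟩
  have hbox' : halfOpenBox B b (-w) B =
      ((hboxfin.toFinset.image fun x => ∑ i ∈ B, g i - x : Finset M) : Set M) := by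
    ext x
    simp only [Finset.coe_image, Set.Finite.coe_toFinset, Set.mem_image]
    constructor
    · intro hx
      refine ⟨∑ i ∈ B, g i - x, ?_, by abel⟩
      simpa using sum_sub_mem_halfOpenBox hb hw' hx
    · rintro ⟨y, hy, rfl⟩
      exact sum_sub_mem_halfOpenBox hb hw hy
  refine IsReciprocal.of_mul_prod B (fun i => deg (g i)) (fun i hi h => ?_) hboxfin.toFinset deg
    (fun x hx => ?_) ?_ ?_
  · have h0 := (hzero _ (generator_mem hb hS hi)).mp h
    have := hb i hi i hi
    simp [h0] at this
  · have := hdeg x (by simpa using hx)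
    omega
  · rw [hilbertSeries_halfOpenCell_mul_prod hadd hfin hb hS w B subset_rfl,
      ← hilbertSeries_finset, Set.Finite.coe_toFinset]
  · rw [hilbertSeries_halfOpenCell_mul_prod hadd hfin hb hS (-w) B subset_rfl, hbox',
      hilbertSeries_finset, Finset.sum_image fun x _ y _ h => sub_right_injective h]
    refine Finset.sum_congr rfl fun x hx => ?_
    have := hdeg x (by simpa using hx)
    congr 1
    beta_reduce
    omega

end SimplicialCell

section DualFeasible

variable {ι E : Type*} [DecidableEq ι] [AddCommGroup E] [Module ℝ E]

/-- The family `g` restricted to `B` is a basis with coordinate functionals `b`. -/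
structure IsCoord (g : ι → E) (B : Finset ι) (b : ι → E →ₗ[ℝ] ℝ) : Prop where
  sum_eq : ∀ x, ∑ i ∈ B, b i x • g i = x
  apply_eq : ∀ i ∈ B, ∀ j ∈ B, b j (g i) = if i = j then 1 else 0

lemma IsCoord.apply_sum {g : ι → E} {B : Finset ι} {b : ι → E →ₗ[ℝ] ℝ} (h : IsCoord g B b)
    (c : ι → ℝ) {j : ι} (hj : j ∈ B) : b j (∑ i ∈ B, c i • g i) = c j := by
  rw [map_sum, Finset.sum_congr rfl fun i hi => by rw [map_smul, h.apply_eq i hi j hj]]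
  simp [hj]

lemma IsCoord.linearIndepOn {g : ι → E} {B : Finset ι} {b : ι → E →ₗ[ℝ] ℝ} (h : IsCoord g B b) :
    LinearIndepOn ℝ g (B : Set ι) := by
  rw [linearIndepOn_finset_iff]
  intro c hc i hi
  rw [← h.apply_sum c hi, hc, map_zero]

lemma exists_isCoord {g : ι → E} {B : Finset ι} (hli : LinearIndepOn ℝ g (B : Set ι))
    (hspan : ⊤ ≤ Submodule.span ℝ (g '' B)) : ∃ b, IsCoord g B b := by
  have hspan' : ⊤ ≤ Submodule.span ℝ (Set.range fun i : (B : Set ι) => g i) := by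
    rwa [← Set.image_eq_range]
  let e := Module.Basis.mk hli hspan'
  refine ⟨fun i => if hi : i ∈ B then e.coord ⟨i, hi⟩ else 0, fun x => ?_, fun i hi j hj => ?_⟩
  · conv_rhs => rw [← e.sum_repr x]
    rw [← Finset.sum_coe_sort B]
    refine Finset.sum_congr rfl fun i _ => ?_
    simp [e]
  · have : g i = e ⟨i, hi⟩ := by simp [e]
    rw [dif_pos hj, this, e.coord_apply, e.repr_self, Finsupp.single_apply]
    simp

lemma IsCoord.card [FiniteDimensional ℝ E] {g : ι → E} {B : Finset ι} {b : ι → E →ₗ[ℝ] ℝ}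
    (h : IsCoord g B b) : B.card = Module.finrank ℝ E := by
  have hli := h.linearIndepOn
  have hspan' : ⊤ ≤ Submodule.span ℝ (Set.range fun i : (B : Set ι) => g i) := by
    intro x _
    rw [← h.sum_eq x]
    exact Submodule.sum_mem _ fun i hi => Submodule.smul_mem _ _
      (Submodule.subset_span ⟨⟨i, hi⟩, rfl⟩)
  rw [Module.finrank_eq_card_basis (Module.Basis.mk hli hspan')]
  simp

/-- The value at `x` of the linear functional taking the value `ω i` at `g i` for `i ∈ B`. -/
def coordCost (ω : ι → ℝ) (B : Finset ι) (b : ι → E →ₗ[ℝ] ℝ) (x : E) : ℝ :=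
  ∑ i ∈ B, b i x * ω i

lemma IsCoord.cost_sum {ω : ι → ℝ} {g : ι → E} {B B' : Finset ι} {b b' : ι → E →ₗ[ℝ] ℝ}
    (h' : IsCoord g B' b') (x : E) :
    coordCost ω B b x = ∑ j ∈ B', b' j x * coordCost ω B b (g j) := by
  conv_lhs => rw [← h'.sum_eq x]
  simp only [coordCost, map_sum, map_smul, smul_eq_mul, Finset.sum_mul, Finset.mul_sum]
  rw [Finset.sum_comm]
  simp only [mul_assoc]

lemma IsCoord.cost_self {ω : ι → ℝ} {g : ι → E} {B : Finset ι} {b : ι → E →ₗ[ℝ] ℝ}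
    (h : IsCoord g B b) {j : ι} (hj : j ∈ B) : coordCost ω B b (g j) = ω j := by
  unfold coordCost
  rw [Finset.sum_congr rfl fun i hi => by rw [h.apply_eq j hj i hi]]
  simp [hj]

lemma IsCoord.cost_lt {ω : ι → ℝ} {g : ι → E} {B B' : Finset ι} {b b' : ι → E →ₗ[ℝ] ℝ}
    (h : IsCoord g B b) (h' : IsCoord g B' b') (hd : ∀ j ∉ B, coordCost ω B b (g j) < ω j)
    {z : E} (hz : ∀ i ∈ B', 0 < b' i z) {j : ι} (hj : j ∈ B') (hjB : j ∉ B) :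
    coordCost ω B b z < coordCost ω B' b' z := by
  rw [h'.cost_sum z]
  refine Finset.sum_lt_sum (fun i hi => ?_) ⟨j, hj, mul_lt_mul_of_pos_left (hd j hjB) (hz j hj)⟩
  refine mul_le_mul_of_nonneg_left ?_ (hz i hi).le
  by_cases hiB : i ∈ B
  · exact (h.cost_self hiB).le
  · exact (hd i hiB).le

lemma IsCoord.eq_of_dualFeasible [FiniteDimensional ℝ E] {ω : ι → ℝ} {g : ι → E}
    {B B' : Finset ι} {b b' : ι → E →ₗ[ℝ] ℝ} (h : IsCoord g B b) (h' : IsCoord g B' b')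
    (hd : ∀ j ∉ B, coordCost ω B b (g j) < ω j) (hd' : ∀ j ∉ B', coordCost ω B' b' (g j) < ω j)
    {z : E} (hz : ∀ i ∈ B, 0 < b i z) (hz' : ∀ i ∈ B', 0 < b' i z) : B = B' := by
  by_contra hne
  have hcard : B.card = B'.card := h.card.trans h'.card.symm
  have h1 : ¬ B' ⊆ B := fun hs => hne (Finset.eq_of_subset_of_card_le hs hcard.le).symm
  have h2 : ¬ B ⊆ B' := fun hs => hne (Finset.eq_of_subset_of_card_le hs hcard.ge)
  obtain ⟨j, hj, hjB⟩ := Finset.not_subset.mp h1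
  obtain ⟨k, hk, hkB⟩ := Finset.not_subset.mp h2
  exact lt_asymm (h.cost_lt h' hd hz' hj hjB) (h'.cost_lt h hd' hz hk hkB)

omit [DecidableEq ι] in
lemma exists_max_step {s : Finset ι} {c a : ι → ℝ} (hc : ∀ i ∈ s, 0 ≤ c i)
    (ha : ∃ i ∈ s, 0 < a i) :
    ∃ h ∈ s, 0 < a h ∧ ∀ i ∈ s, 0 ≤ c i - c h / a h * a i := by
  obtain ⟨i₀, hi₀, hai₀⟩ := ha
  obtain ⟨h, hh, hmin⟩ := Finset.exists_min_image (s.filter fun i => 0 < a i)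
    (fun i => c i / a i) ⟨i₀, by simp [hi₀, hai₀]⟩
  simp only [Finset.mem_filter] at hh hmin
  refine ⟨h, hh.1, hh.2, fun i hi => ?_⟩
  by_cases hai : 0 < a i
  · have := hmin i ⟨hi, hai⟩
    rw [le_div_iff₀ hai] at this
    linarith
  · have : c h / a h * a i ≤ 0 :=
      mul_nonpos_of_nonneg_of_nonpos (div_nonneg (hc h hh.1) hh.2.le) (not_lt.mp hai)
    linarith [hc i hi]

/-- Carathéodory's theorem for finitely generated cones. -/
lemma exists_linearIndepOn_nonneg_comb [Fintype ι] {g : ι → E} {z : E}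
    (hz : ∃ c : ι → ℝ, (∀ i, 0 ≤ c i) ∧ ∑ i, c i • g i = z) :
    ∃ (s : Finset ι) (c : ι → ℝ), (∀ i, 0 ≤ c i) ∧ (∀ i ∉ s, c i = 0) ∧
      ∑ i, c i • g i = z ∧ LinearIndepOn ℝ g (s : Set ι) := by
  obtain ⟨c₀, hc₀, hcz₀⟩ := hz
  classical
  obtain ⟨s, hs, hmin⟩ := Finset.exists_min_image
    (Finset.univ.filter fun s : Finset ι => ∃ c : ι → ℝ, (∀ i, 0 ≤ c i) ∧ (∀ i ∉ s, c i = 0) ∧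
      ∑ i, c i • g i = z) Finset.card ⟨Finset.univ, by simpa using ⟨c₀, hc₀, hcz₀⟩⟩
  obtain ⟨-, c, hc, hcs, hcz⟩ := Finset.mem_filter.mp hs
  refine ⟨s, c, hc, hcs, hcz, ?_⟩
  by_contra hdep
  obtain ⟨a, ha, hapos⟩ : ∃ a : ι → ℝ, ∑ i ∈ s, a i • g i = 0 ∧ ∃ i ∈ s, 0 < a i := by
    obtain ⟨a, ha, i, hi, hne⟩ := not_linearIndepOn_finset_iff.mp hdep
    rcases hne.lt_or_gt with hlt | hgt
    · exact ⟨-a, by simp [ha], i, hi, by simpa using hlt⟩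
    · exact ⟨a, ha, i, hi, hgt⟩
  obtain ⟨h, hh, hah, hstep⟩ := exists_max_step (fun i _ => hc i) hapos
  have hlt : (s.erase h).card < s.card := Finset.card_erase_lt_of_mem hh
  refine absurd (hmin (s.erase h) ?_) (not_le.mpr hlt)
  refine Finset.mem_filter.mpr ⟨Finset.mem_univ _,
    fun i => if i ∈ s then c i - c h / a h * a i else 0, fun i => ?_, fun i hi => ?_, ?_⟩
  · by_cases his : i ∈ s
    · simpa [his] using hstep i his
    · simp [his]
  · rcases eq_or_ne i h with rfl | hne
    · simp [hh, hah.ne']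
    · have : i ∉ s := fun his => hi (Finset.mem_erase.mpr ⟨hne, his⟩)
      simp [this]
  · rw [← hcz, ← Finset.sum_subset (Finset.subset_univ s) (f := fun i => c i • g i)
      fun i _ hi => by simp [hcs i hi]]
    simp only [ite_smul, zero_smul, Finset.sum_ite_mem, Finset.univ_inter, sub_smul, mul_smul,
      Finset.sum_sub_distrib, ← Finset.smul_sum, ha, smul_zero, sub_zero]

/-- The finitely generated cone spanned by `g`. -/
def coneOf [Fintype ι] (g : ι → E) : Set E :=
  {x | ∃ c : ι → ℝ, (∀ i, 0 ≤ c i) ∧ ∑ i, c i • g i = x}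

variable [Fintype ι]

lemma sum_mem_coneOf {g : ι → E} {B : Finset ι} {c : ι → ℝ} (hc : ∀ i ∈ B, 0 ≤ c i) :
    ∑ i ∈ B, c i • g i ∈ coneOf g := by
  refine ⟨fun i => if i ∈ B then c i else 0, fun i => ?_, ?_⟩
  · beta_reduce
    split_ifs with h
    · exact hc i h
    · exact le_rfl
  · simp [ite_smul]

lemma IsCoord.mem_coneOf {g : ι → E} {B : Finset ι} {b : ι → E →ₗ[ℝ] ℝ} (h : IsCoord g B b)
    {x : E} (hx : ∀ i ∈ B, 0 ≤ b i x) : x ∈ coneOf g := by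
  rw [← h.sum_eq x]
  exact sum_mem_coneOf hx

lemma exists_feasible {g : ι → E} (hspan : Submodule.span ℝ (Set.range g) = ⊤) {z : E}
    (hz : z ∈ coneOf g) : ∃ B b, IsCoord g B b ∧ ∀ i ∈ B, 0 ≤ b i z := by
  classical
  obtain ⟨s, c, hc, hcs, hcz, hli⟩ := exists_linearIndepOn_nonneg_comb hz
  obtain ⟨B', -, hsB, hsp, hli'⟩ := exists_linearIndepOn_extension hli (Set.subset_univ _)
  obtain ⟨B, rfl⟩ : ∃ B : Finset ι, (B : Set ι) = B' := ⟨B'.toFinset, by simp⟩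
  obtain ⟨b, hb⟩ := exists_isCoord hli' (by
    rw [← hspan, Submodule.span_le, ← Set.image_univ]; exact hsp)
  refine ⟨B, b, hb, fun i hi => ?_⟩
  have : z = ∑ i ∈ B, c i • g i := by
    rw [← hcz]
    refine (Finset.sum_subset (Finset.subset_univ B) fun i _ hi => ?_).symm
    rw [hcs i fun his => hi (hsB his), zero_smul]
  rw [this, hb.apply_sum c hi]
  exact hc i

omit [Fintype ι] in
/-- One pivot step of the simplex method. -/
lemma IsCoord.exists_pivot {g : ι → E} {B : Finset ι} {b : ι → E →ₗ[ℝ] ℝ}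
    (hB : IsCoord g B b) {ω : ι → ℝ} {z : E} (hz : ∀ i ∈ B, 0 < b i z) {j : ι} (hj : j ∉ B)
    (hpos : ∃ i ∈ B, 0 < b i (g j)) (hcost : ω j < coordCost ω B b (g j)) :
    ∃ B' b', IsCoord g B' b' ∧ (∀ i ∈ B', 0 ≤ b' i z) ∧
      coordCost ω B' b' z < coordCost ω B b z := by
  obtain ⟨h, hh, hah, hstep⟩ := exists_max_step (fun i hi => (hz i hi).le) hpos
  set ε := b h z / b h (g j) with hε
  have hεpos : 0 < ε := div_pos (hz h hh) hah
  have hjB : j ∉ B.erase h := fun hmem => hj (Finset.mem_of_mem_erase hmem)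
  have hg : g j = b h (g j) • g h + ∑ i ∈ B.erase h, b i (g j) • g i := by
    rw [Finset.add_sum_erase B (fun i => b i (g j) • g i) hh, hB.sum_eq]
  have hli : LinearIndepOn ℝ g ((insert j (B.erase h) : Finset ι) : Set ι) := by
    rw [Finset.coe_insert, linearIndepOn_insert (by simpa using fun hjB' => absurd hjB' hj)]
    refine ⟨hB.linearIndepOn.mono (by simp), fun hmem => hah.ne' ?_⟩
    have : Submodule.span ℝ (g '' (B.erase h : Finset ι)) ≤ LinearMap.ker (b h) := by
      rw [Submodule.span_le]
      rintro _ ⟨i, hi, rfl⟩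
      obtain ⟨hih, hiB⟩ := Finset.mem_erase.mp (Finset.mem_coe.mp hi)
      simp [hB.apply_eq i hiB h hh, hih]
    exact this hmem
  have hspan : ⊤ ≤ Submodule.span ℝ (g '' ((insert j (B.erase h) : Finset ι) : Set ι)) := by
    have hmem : ∀ i ∈ insert j (B.erase h),
        g i ∈ Submodule.span ℝ (g '' ((insert j (B.erase h) : Finset ι) : Set ι)) :=
      fun i hi => Submodule.subset_span ⟨i, hi, rfl⟩
    have hmem' : ∀ i ∈ B,
        g i ∈ Submodule.span ℝ (g '' ((insert j (B.erase h) : Finset ι) : Set ι)) := by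
      intro i hi
      rcases eq_or_ne i h with rfl | hih
      · have : g i = (b i (g j))⁻¹ • (g j - ∑ k ∈ B.erase i, b k (g j) • g k) := by
          rw [eq_inv_smul_iff₀ hah.ne', eq_sub_iff_add_eq]
          exact hg.symm
        rw [this]
        exact Submodule.smul_mem _ _ (Submodule.sub_mem _ (hmem j (by simp))
          (Submodule.sum_mem _ fun k hk => Submodule.smul_mem _ _
            (hmem k (Finset.mem_insert_of_mem hk))))
      · exact hmem i (by simp [hih, hi])
    intro x _
    rw [← hB.sum_eq x]
    exact Submodule.sum_mem _ fun i hi => Submodule.smul_mem _ _ (hmem' i hi)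
  obtain ⟨b', hb'⟩ := exists_isCoord hli hspan
  set c : ι → ℝ := fun i => if i = j then ε else b i z - ε * b i (g j) with hc
  have hcj : c j = ε := by simp [hc]
  have hch : b h z - ε * b h (g j) = 0 := by rw [hε]; field_simp; ring
  have hci : ∀ i ∈ B.erase h, c i = b i z - ε * b i (g j) := by
    intro i hi
    have : i ≠ j := by rintro rfl; exact hjB hi
    simp [hc, this]
  have hsum : z = ∑ i ∈ insert j (B.erase h), c i • g i := by
    rw [Finset.sum_insert hjB, hcj, Finset.sum_congr rfl fun i hi => by rw [hci i hi]]
    have h1 := Finset.add_sum_erase B (fun i => (b i z - ε * b i (g j)) • g i) hh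
    simp only [hch, zero_smul, zero_add] at h1
    rw [h1]
    simp only [sub_smul, mul_smul, Finset.sum_sub_distrib, ← Finset.smul_sum, hB.sum_eq]
    abel
  have hbc : ∀ i ∈ insert j (B.erase h), b' i z = c i := fun i hi => by
    conv_lhs => rw [hsum]
    exact hb'.apply_sum c hi
  refine ⟨_, b', hb', fun i hi => ?_, ?_⟩
  · rw [hbc i hi]
    rcases Finset.mem_insert.mp hi with rfl | hi
    · rw [hcj]; exact hεpos.le
    · rw [hci i hi]; exact hstep i (Finset.mem_of_mem_erase hi)
  · have h1 := Finset.add_sum_erase B (fun i => (b i z - ε * b i (g j)) * ω i) hh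
    simp only [hch, zero_mul, zero_add] at h1
    have h2 : coordCost ω (insert j (B.erase h)) b' z =
        coordCost ω B b z - ε * (coordCost ω B b (g j) - ω j) := by
      unfold coordCost
      rw [Finset.sum_congr rfl fun i hi => by rw [hbc i hi], Finset.sum_insert hjB, hcj,
        Finset.sum_congr rfl fun i hi => by rw [hci i hi], h1]
      simp only [sub_mul, Finset.sum_sub_distrib, mul_assoc, ← Finset.mul_sum]
      ring
    rw [h2]
    have := mul_pos hεpos (sub_pos.mpr hcost)
    linarith

/-- A generic point of a pointed finitely generated cone lies in a dual feasible simplicial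
cone. -/
lemma exists_dualFeasible {g : ι → E} (hspan : Submodule.span ℝ (Set.range g) = ⊤)
    (hpointed : ∀ x ∈ coneOf g, -x ∈ coneOf g → x = 0) (hg0 : ∀ i, g i ≠ 0)
    {β : Finset ι → ι → E →ₗ[ℝ] ℝ} (hβ : ∀ B, (∃ b, IsCoord g B b) → IsCoord g B (β B))
    {ω : ι → ℝ} (hω : ∀ B, IsCoord g B (β B) → ∀ j ∉ B, coordCost ω B (β B) (g j) ≠ ω j)
    {z : E} (hz : ∀ B, IsCoord g B (β B) → ∀ i ∈ B, β B i z ≠ 0) (hzC : z ∈ coneOf g) :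
    ∃ B, IsCoord g B (β B) ∧ (∀ j ∉ B, coordCost ω B (β B) (g j) < ω j) ∧
      ∀ i ∈ B, 0 < β B i z := by
  classical
  have huniq : ∀ {B b}, IsCoord g B b → ∀ i ∈ B, b i z = β B i z := by
    intro B b hb i hi
    conv_lhs => rw [← (hβ B ⟨b, hb⟩).sum_eq z]
    exact hb.apply_sum (fun i => β B i z) hi
  have hposz : ∀ {B b}, IsCoord g B b → (∀ i ∈ B, 0 ≤ b i z) → ∀ i ∈ B, 0 < β B i z := by
    intro B b hb h i hi
    refine lt_of_le_of_ne ?_ (hz B (hβ B ⟨b, hb⟩) i hi).symm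
    rw [← huniq hb i hi]
    exact h i hi
  obtain ⟨B₀, b₀, hB₀, hz₀⟩ := exists_feasible hspan hzC
  obtain ⟨B, hB, hmin⟩ := Finset.exists_min_image
    (Finset.univ.filter fun B : Finset ι => IsCoord g B (β B) ∧ ∀ i ∈ B, 0 < β B i z)
    (fun B => coordCost ω B (β B) z) ⟨B₀, by
      simpa using ⟨hβ _ ⟨_, hB₀⟩, hposz hB₀ hz₀⟩⟩
  obtain ⟨-, hB, hBz⟩ := Finset.mem_filter.mp hB
  refine ⟨B, hB, fun j hj => ?_, hBz⟩
  refine lt_of_le_of_ne ?_ (hω B hB j hj)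
  by_contra! hcost
  have hpos : ∃ i ∈ B, 0 < β B i (g j) := by
    by_contra! hneg
    refine hg0 j (hpointed _ ?_ (hB.mem_coneOf fun i hi => ?_))
    · simpa using sum_mem_coneOf (g := g) (B := {j}) (c := 1) (by simp)
    · rw [map_neg]; linarith [hneg i hi]
  obtain ⟨B', b', hB', hz', hlt⟩ := hB.exists_pivot hBz hj hpos hcost
  have hcost' : coordCost ω B' b' z = coordCost ω B' (β B') z :=
    Finset.sum_congr rfl fun i hi => by rw [huniq hB' i hi]
  rw [hcost'] at hlt
  refine absurd (hmin B' ?_) (not_le.mpr hlt)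
  simpa using ⟨hβ _ ⟨_, hB'⟩, hposz hB' hz'⟩

end DualFeasible

section Decomposition

open Filter Topology
open scoped Pointwise

lemma eventually_lexPos_iff {w : ℝ} (hw : w ≠ 0) (t : ℝ) :
    ∀ᶠ ε in 𝓝[>] (0 : ℝ), t + ε * w ≠ 0 ∧ (0 < t + ε * w ↔ LexPos w t) := by
  have htend : Tendsto (fun ε : ℝ => t + ε * w) (𝓝[>] 0) (𝓝 t) := by
    have : Continuous fun ε : ℝ => t + ε * w := by fun_prop
    simpa using (this.tendsto 0).mono_left nhdsWithin_le_nhds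
  rcases lt_trichotomy t 0 with ht | rfl | ht
  · filter_upwards [htend.eventually_lt_const ht] with ε hε
    exact ⟨hε.ne, iff_of_false hε.not_gt fun h => h.nonneg.not_gt ht⟩
  · filter_upwards [self_mem_nhdsWithin] with ε hε
    have hε : 0 < ε := hε
    simp [LexPos, hε, hε.ne', hw]
  · filter_upwards [htend.eventually_const_lt ht] with ε hε
    exact ⟨hε.ne', iff_of_true hε (Or.inl ht)⟩

variable {ι E : Type*} [Fintype ι] [NormedAddCommGroup E] [NormedSpace ℝ E]

lemma add_mem_coneOf {g : ι → E} {x y : E} (hx : x ∈ coneOf g) (hy : y ∈ coneOf g) :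
    x + y ∈ coneOf g := by
  obtain ⟨c, hc, rfl⟩ := hx
  obtain ⟨d, hd, rfl⟩ := hy
  exact ⟨c + d, fun i => add_nonneg (hc i) (hd i), by simp [add_smul, Finset.sum_add_distrib]⟩

lemma smul_mem_coneOf {g : ι → E} {x : E} (hx : x ∈ coneOf g) {r : ℝ} (hr : 0 ≤ r) :
    r • x ∈ coneOf g := by
  obtain ⟨c, hc, rfl⟩ := hx
  exact ⟨r • c, fun i => mul_nonneg hr (hc i), by simp [mul_smul, Finset.smul_sum]⟩

lemma add_smul_mem_interior_coneOf {g : ι → E} {x v : E} (hx : x ∈ coneOf g)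
    (hv : v ∈ interior (coneOf g)) {r : ℝ} (hr : 0 < r) : x + r • v ∈ interior (coneOf g) := by
  refine mem_interior.mpr ⟨{x} + r • interior (coneOf g), ?_,
    (isOpen_interior.smul₀ hr.ne').add_left, ?_⟩
  · rintro _ ⟨_, rfl, _, ⟨y, hy, rfl⟩, rfl⟩
    exact add_mem_coneOf hx (smul_mem_coneOf (interior_subset hy) hr.le)
  · exact ⟨x, rfl, _, ⟨v, hv, rfl⟩, rfl⟩

/-- Decomposition of a full-dimensional pointed cone and of its interior into half-open simplicial
cones. -/
lemma exists_halfOpen_decomposition [DecidableEq ι] [FiniteDimensional ℝ E] {g : ι → E} (hspan : Submodule.span ℝ (Set.range g) = ⊤)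
    (hpointed : ∀ x ∈ coneOf g, -x ∈ coneOf g → x = 0) (hg0 : ∀ i, g i ≠ 0)
    (hint : (interior (coneOf g)).Nonempty) :
    ∃ (T : Finset (Finset ι)) (β : Finset ι → ι → E →ₗ[ℝ] ℝ) (v : E),
      (∀ B ∈ T, IsCoord g B (β B)) ∧ (∀ B ∈ T, ∀ i ∈ B, β B i v ≠ 0) ∧
      (∀ x, x ∈ coneOf g ↔ ∃ B ∈ T, ∀ i ∈ B, LexPos (β B i v) (β B i x)) ∧
      (∀ x, x ∈ interior (coneOf g) ↔ ∃ B ∈ T, ∀ i ∈ B, LexPos (β B i (-v)) (β B i x)) ∧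
      ∀ w : E, w = v ∨ w = -v → ∀ x, ∀ B ∈ T, ∀ B' ∈ T,
        (∀ i ∈ B, LexPos (β B i w) (β B i x)) → (∀ i ∈ B', LexPos (β B' i w) (β B' i x)) →
        B = B' := by
  classical
  obtain ⟨β, hβ⟩ : ∃ β : Finset ι → ι → E →ₗ[ℝ] ℝ,
      ∀ B, (∃ b, IsCoord g B b) → IsCoord g B (β B) := by
    refine ⟨fun B => if h : ∃ b, IsCoord g B b then h.choose else 0, fun B h => ?_⟩
    beta_reduce
    rw [dif_pos h]
    exact h.choose_spec
  obtain ⟨ω, hω⟩ : ∃ ω : ι → ℝ,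
      ∀ B, IsCoord g B (β B) → ∀ j ∉ B, coordCost ω B (β B) (g j) ≠ ω j := by
    obtain ⟨ω, hω⟩ := Module.Dual.exists_forall_ne_zero_of_forall_exists
      (fun p : {p : Finset ι × ι // IsCoord g p.1 (β p.1) ∧ p.2 ∉ p.1} =>
        (∑ i ∈ p.1.1, β p.1.1 i (g p.1.2) • LinearMap.proj i - LinearMap.proj p.1.2 :
          Module.Dual ℝ (ι → ℝ))) (by
        rintro ⟨⟨B, j⟩, -, hj⟩
        refine ⟨Pi.single j 1, ?_⟩
        have h0 : ∀ i ∈ B, β B i (g j) * (Pi.single j 1 : ι → ℝ) i = 0 := by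
          intro i hi
          have : i ≠ j := by rintro rfl; exact hj hi
          simp [this]
        simp only [LinearMap.sub_apply, LinearMap.sum_apply, LinearMap.smul_apply,
          LinearMap.proj_apply, smul_eq_mul]
        rw [Finset.sum_eq_zero h0]
        simp)
    refine ⟨ω, fun B hB j hj h => hω ⟨(B, j), hB, hj⟩ ?_⟩
    simpa [coordCost, sub_eq_zero] using h
  obtain ⟨v, hvint, hv⟩ : ∃ v ∈ interior (coneOf g),
      ∀ B, IsCoord g B (β B) → ∀ i ∈ B, β B i v ≠ 0 := by
    obtain ⟨c, hc⟩ := hint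
    obtain ⟨u, hu⟩ := Module.Dual.exists_forall_ne_zero_of_forall_exists
      (fun p : {p : Finset ι × ι // IsCoord g p.1 (β p.1) ∧ p.2 ∈ p.1} =>
        (β p.1.1 p.1.2 : Module.Dual ℝ E)) (by
        rintro ⟨⟨B, i⟩, hB, hi⟩
        exact ⟨g i, by simp [hB.apply_eq i hi i hi]⟩)
    have h1 : ∀ᶠ ε in 𝓝[>] (0 : ℝ), c + ε • u ∈ interior (coneOf g) := by
      have : Continuous fun ε : ℝ => c + ε • u := by fun_prop
      refine nhdsWithin_le_nhds (this.tendsto 0 (isOpen_interior.mem_nhds ?_))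
      simpa using hc
    have h2 : ∀ᶠ ε in 𝓝[>] (0 : ℝ),
        ∀ p : {p : Finset ι × ι // IsCoord g p.1 (β p.1) ∧ p.2 ∈ p.1},
          β p.1.1 p.1.2 c + ε * β p.1.1 p.1.2 u ≠ 0 :=
      eventually_all.mpr fun p => (eventually_lexPos_iff (hu p) _).mono fun _ h => h.1
    obtain ⟨ε, hε1, hε2⟩ := (h1.and h2).exists
    refine ⟨_, hε1, fun B hB i hi => ?_⟩
    simpa using hε2 ⟨(B, i), hB, hi⟩
  have hev : ∀ w : E, (∀ B, IsCoord g B (β B) → ∀ i ∈ B, β B i w ≠ 0) → ∀ x,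
      ∀ᶠ ε in 𝓝[>] (0 : ℝ), ∀ B, IsCoord g B (β B) → ∀ i ∈ B, β B i (x + ε • w) ≠ 0 ∧
        (0 < β B i (x + ε • w) ↔ LexPos (β B i w) (β B i x)) := by
    intro w hw x
    refine eventually_all.mpr fun B => ?_
    by_cases hB : IsCoord g B (β B)
    · refine Eventually.mono (eventually_all.mpr fun i : B =>
        eventually_lexPos_iff (hw B hB i i.2) (β B i x)) fun ε h _ i hi => ?_
      simpa using h ⟨i, hi⟩
    · exact Eventually.of_forall fun _ h => absurd h hB
  set T : Finset (Finset ι) := Finset.univ.filter fun B =>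
    IsCoord g B (β B) ∧ ∀ j ∉ B, coordCost ω B (β B) (g j) < ω j with hT
  have hTmem : ∀ B, B ∈ T ↔ IsCoord g B (β B) ∧ ∀ j ∉ B, coordCost ω B (β B) (g j) < ω j := by
    simp [hT]
  have hcover : ∀ w : E, (∀ B, IsCoord g B (β B) → ∀ i ∈ B, β B i w ≠ 0) → ∀ x,
      (∀ᶠ ε in 𝓝[>] (0 : ℝ), x + ε • w ∈ coneOf g) →
      ∃ B ∈ T, ∀ i ∈ B, LexPos (β B i w) (β B i x) := by
    intro w hw x hx
    obtain ⟨ε, hε, hmem⟩ := ((hev w hw x).and hx).exists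
    obtain ⟨B, hB, hBd, hpos⟩ := exists_dualFeasible hspan hpointed hg0 hβ hω
      (fun B hB i hi => (hε B hB i hi).1) hmem
    exact ⟨B, (hTmem B).mpr ⟨hB, hBd⟩, fun i hi => (hε B hB i hi).2.mp (hpos i hi)⟩
  have hvneg : ∀ B, IsCoord g B (β B) → ∀ i ∈ B, β B i (-v) ≠ 0 := fun B hB i hi => by
    rw [map_neg]; exact neg_ne_zero.mpr (hv B hB i hi)
  refine ⟨T, β, v, fun B hB => ((hTmem B).mp hB).1, fun B hB => hv B ((hTmem B).mp hB).1,
    fun x => ⟨fun hx => hcover v hv x ?_, ?_⟩, fun x => ⟨fun hx => hcover (-v) hvneg x ?_, ?_⟩, ?_⟩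
  · filter_upwards [self_mem_nhdsWithin] with ε hε
    exact interior_subset (add_smul_mem_interior_coneOf hx hvint hε)
  · rintro ⟨B, hB, h⟩
    exact ((hTmem B).mp hB).1.mem_coneOf fun i hi => (h i hi).nonneg
  · have : Continuous fun ε : ℝ => x + ε • -v := by fun_prop
    refine nhdsWithin_le_nhds (this.tendsto 0 (mem_interior_iff_mem_nhds.mp ?_))
    simpa using hx
  · rintro ⟨B, hB, h⟩
    have hB' := ((hTmem B).mp hB).1
    obtain ⟨ε, hε, hε0⟩ := ((hev (-v) hvneg x).and self_mem_nhdsWithin).exists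
    have hmem : x + ε • -v ∈ coneOf g :=
      hB'.mem_coneOf fun i hi => ((hε B hB' i hi).2.mpr (h i hi)).le
    have := add_smul_mem_interior_coneOf hmem hvint hε0
    simpa using this
  · intro w hw x B hB B' hB' h h'
    have hw' : ∀ B, IsCoord g B (β B) → ∀ i ∈ B, β B i w ≠ 0 := by
      rcases hw with rfl | rfl
      · exact hv
      · exact hvneg
    obtain ⟨ε, hε⟩ := (hev w hw' x).exists
    obtain ⟨hBc, hBd⟩ := (hTmem B).mp hB
    obtain ⟨hBc', hBd'⟩ := (hTmem B').mp hB'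
    exact hBc.eq_of_dualFeasible hBc' hBd hBd' (fun i hi => (hε B hBc i hi).2.mpr (h i hi))
      fun i hi => (hε B' hBc' i hi).2.mpr (h' i hi)

end Decomposition

section Lattice

lemma exists_pos_mul_eq_intCast {κ : Type*} [Fintype κ] (q : κ → ℚ) :
    ∃ (N : ℕ) (z : κ → ℤ), 0 < N ∧ ∀ k, (z k : ℚ) = N * q k := by
  classical
  refine ⟨∏ k, (q k).den, fun k => (q k).num * ∏ j ∈ Finset.univ.erase k, ((q j).den : ℤ),
    Finset.prod_pos fun k _ => (q k).den_pos, fun k => ?_⟩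
  rw [← Finset.mul_prod_erase Finset.univ (fun k => (q k).den) (Finset.mem_univ k)]
  push_cast
  rw [mul_right_comm, mul_comm ((q k).den : ℚ), Rat.mul_den_eq_num]

/-- A rational cone is generated by finitely many nonzero lattice vectors. -/
lemma exists_lattice_generators {κ : Type*} [Fintype κ] (G : Finset (κ → ℚ)) :
    ∃ (G' : Finset (κ → ℚ)) (g : G' → κ → ℤ), (∀ i, g i ≠ 0) ∧
      {x | ∃ c : (κ → ℚ) → ℝ, (∀ q, 0 ≤ c q) ∧ x = ∑ q ∈ G, c q • (fun i => ((q i : ℝ)))} =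
        coneOf fun i k => (g i k : ℝ) := by
  classical
  choose N z hN hz using fun q : κ → ℚ => exists_pos_mul_eq_intCast q
  have hNR : ∀ q, (0 : ℝ) < N q := fun q => by exact_mod_cast hN q
  have hzR : ∀ q, (fun k => (z q k : ℝ)) = (N q : ℝ) • fun k => (q k : ℝ) := by
    intro q
    ext k
    simp only [Pi.smul_apply, smul_eq_mul]
    exact_mod_cast hz q k
  have hsum : ∀ c : (κ → ℚ) → ℝ, ∑ q ∈ G, c q • (fun i => ((q i : ℝ))) =
      ∑ q : (G.filter (· ≠ 0) : Finset (κ → ℚ)), c q • (fun i => ((q.1 i : ℝ))) := by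
    intro c
    rw [Finset.sum_coe_sort (G.filter (· ≠ 0)) fun q => c q • (fun i => ((q i : ℝ))),
      Finset.sum_filter_of_ne]
    rintro q - hq rfl
    refine hq ?_
    ext i
    simp
  refine ⟨G.filter (· ≠ 0), fun i => z i, fun i h0 => ?_, ?_⟩
  · refine (Finset.mem_filter.mp i.2).2 ?_
    ext k
    have := hz (i : κ → ℚ) k
    rw [show z i = 0 from h0] at this
    simpa [(hN i).ne'] using this
  · ext x
    constructor
    · rintro ⟨c, hc, rfl⟩
      refine ⟨fun q => c q / N q, fun q => div_nonneg (hc q) (hNR q).le, ?_⟩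
      rw [hsum]
      refine Finset.sum_congr rfl fun q _ => ?_
      beta_reduce
      rw [hzR, smul_smul, div_mul_cancel₀ _ (hNR q).ne']
    · rintro ⟨c, hc, rfl⟩
      refine ⟨fun q => if h : q ∈ G.filter (· ≠ 0) then c ⟨q, h⟩ * N q else 0, fun q => ?_, ?_⟩
      · beta_reduce
        split_ifs with h
        · exact mul_nonneg (hc _) (hNR q).le
        · exact le_rfl
      · rw [hsum]
        refine Finset.sum_congr rfl fun q _ => ?_
        beta_reduce
        rw [hzR, smul_smul, dif_pos q.2]

/-- Stanley reciprocity for the lattice points of a pointed rational cone. -/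
lemma isReciprocal_interior_coneOf {ι κ : Type*} [Fintype ι] [DecidableEq ι] [Fintype κ]
    {g : ι → κ → ℤ} (hg0 : ∀ i, g i ≠ 0) {C : Set (κ → ℝ)} (hC : C = coneOf fun i k => (g i k : ℝ))
    (hpointed : ∀ x ∈ C, -x ∈ C → x = 0) (hint : (interior C).Nonempty)
    (hspan : Submodule.span ℝ C = ⊤) {deg : (κ → ℤ) → ℕ}
    {S : AddSubmonoid (κ → ℤ)} (hS : ∀ x : κ → ℤ, x ∈ S ↔ (fun k => (x k : ℝ)) ∈ C)
    (hadd : ∀ a ∈ S, ∀ b ∈ S, deg (a + b) = deg a + deg b)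
    (hzero : ∀ a ∈ S, (deg a = 0 ↔ a = 0))
    (hfin : ∀ r : ℕ, {a | a ∈ S ∧ deg a = r}.Finite) :
    IsReciprocal (Fintype.card κ) (hilbertSeries deg (S : Set (κ → ℤ)))
      (hilbertSeries deg {x : κ → ℤ | (fun k => (x k : ℝ)) ∈ interior C}) := by
  classical
  set gR : ι → κ → ℝ := fun i k => (g i k : ℝ) with hgR
  subst hC
  have hspan' : Submodule.span ℝ (Set.range gR) = ⊤ := by
    rw [← top_le_iff, ← hspan, Submodule.span_le]
    rintro _ ⟨c, -, rfl⟩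
    exact Submodule.sum_mem _ fun i _ => Submodule.smul_mem _ _ (Submodule.subset_span ⟨i, rfl⟩)
  have hgR0 : ∀ i, gR i ≠ 0 := by
    intro i h
    refine hg0 i ?_
    ext k
    simpa [hgR] using congrFun h k
  obtain ⟨T, β, v, hcoord, hv, hcone, hinterior, hdisj⟩ :=
    exists_halfOpen_decomposition hspan' hpointed hgR0 hint
  let toReal : (κ → ℤ) →+ (κ → ℝ) := (Int.castAddHom ℝ).compLeft κ
  have htoReal : ∀ x : κ → ℤ, toReal x = fun k => (x k : ℝ) := fun x => rfl
  let b : Finset ι → ι → (κ → ℤ) →+ ℝ := fun B i => (β B i).toAddMonoidHom.comp toReal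
  have hb : ∀ B i x, b B i x = β B i fun k => (x k : ℝ) := fun B i x => rfl
  have hcell : ∀ w : κ → ℝ, ∀ B x, x ∈ halfOpenCell B (b B) (fun i => β B i w) ↔
      ∀ i ∈ B, LexPos (β B i w) (β B i fun k => (x k : ℝ)) := fun w B x => Iff.rfl
  have hsub : ∀ B ∈ T, ∀ x, (∀ i ∈ B, 0 ≤ b B i x) → x ∈ S := fun B hB x hx =>
    (hS x).mpr ((hcoord B hB).mem_coneOf hx)
  have hseries : ∀ w : κ → ℝ, w = v ∨ w = -v →
      hilbertSeries deg (⋃ B ∈ T, halfOpenCell B (b B) (fun i => β B i w)) =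
        ∑ B ∈ T, hilbertSeries deg (halfOpenCell B (b B) (fun i => β B i w)) := by
    intro w hw
    refine hilbertSeries_biUnion T (fun B hB r => (hfin r).subset fun x hx =>
      ⟨hsub B hB x fun i hi => (hx.1 i hi).nonneg, hx.2⟩) fun B hB B' hB' hne => ?_
    refine Set.disjoint_left.mpr fun x hx hx' => hne ?_
    exact hdisj w hw _ B hB B' hB' hx hx'
  have hScells : (S : Set (κ → ℤ)) = ⋃ B ∈ T, halfOpenCell B (b B) (fun i => β B i v) := by
    ext x
    simp only [SetLike.mem_coe, hS, hcone, Set.mem_iUnion, hcell, exists_prop]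
  have hintcells : {x : κ → ℤ | (fun k => (x k : ℝ)) ∈ interior (coneOf gR)} =
      ⋃ B ∈ T, halfOpenCell B (b B) (fun i => β B i (-v)) := by
    ext x
    simp only [Set.mem_iUnion, hcell, exists_prop, ← hinterior]
    rfl
  rw [hintcells, hScells, hseries v (Or.inl rfl), hseries (-v) (Or.inr rfl)]
  refine IsReciprocal.sum T fun B hB => ?_
  have hcard : B.card = Fintype.card κ := by simpa using (hcoord B hB).card
  have hneg : (fun i => β B i (-v)) = -fun i => β B i v := by
    ext i
    simp
  rw [← hcard, hneg]
  exact isReciprocal_halfOpenCell hadd hzero hfin (g := g)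
    (fun i hi j hj => (hcoord B hB).apply_eq i hi j hj) (hsub B hB) (hv B hB)

end Lattice

/-- Stanley's functional equation for Gorenstein normal semigroups.  Let
`S = C ∩ ℤ^n` for a pointed full-dimensional rational polyhedral cone `C ⊆ ℝ^n`, graded
by `deg` with finite graded pieces, and suppose `ℂ[S]` is Gorenstein (equivalently, by
the Danilov–Stanley criterion, the interior lattice points of `C` form a translate
`c + S` of `S`).  Then the Hilbert series `H_S(t) = Σ_r #(S_r)tʳ` is a rational function
`p/q` satisfying `H_S(t) = (-1)^n t^a H_S(1/t)` for some integer `a`. -/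
theorem gorenstein_hilbert_series_functional_equation (n : ℕ)
    (C : Set (Fin n → ℝ)) (G : Finset (Fin n → ℚ))
    (hpoly : C = {x | ∃ c : (Fin n → ℚ) → ℝ, (∀ g, 0 ≤ c g) ∧
      x = ∑ g ∈ G, c g • (fun i => ((g i : ℝ)))})
    (hpointed : C ∩ (-C) = {0})
    (hfull : Submodule.span ℝ C = ⊤)
    (S : Set (Fin n → ℤ)) (hSdef : S = {x | (fun i => (x i : ℝ)) ∈ C})
    (deg : (Fin n → ℤ) → ℕ)
    (hadd : ∀ a ∈ S, ∀ b ∈ S, deg (a + b) = deg a + deg b)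
    (hzero : ∀ a ∈ S, (deg a = 0 ↔ a = 0))
    (hfin : ∀ r : ℕ, {a ∈ S | deg a = r}.Finite)
    -- Gorenstein hypothesis (Danilov–Stanley): the interior lattice points of `C`
    -- are a translate of `S` by a lattice point `c`.
    (hGor : ∃ c ∈ S, {x : Fin n → ℤ | (fun i => (x i : ℝ)) ∈ interior C} =
      (fun s => c + s) '' S) :
    ∃ (p q : Polynomial ℚ) (a : ℤ), q ≠ 0 ∧
      (PowerSeries.mk fun r => ({x ∈ S | deg x = r}.ncard : ℚ)) * (q : PowerSeries ℚ)
        = (p : PowerSeries ℚ) ∧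
      (algebraMap (Polynomial ℚ) (RatFunc ℚ) p) / (algebraMap (Polynomial ℚ) (RatFunc ℚ) q)
        = (-1 : RatFunc ℚ) ^ n * (RatFunc.X : RatFunc ℚ) ^ a *
          ((p.eval₂ (algebraMap ℚ (RatFunc ℚ)) (RatFunc.X)⁻¹) /
           (q.eval₂ (algebraMap ℚ (RatFunc ℚ)) (RatFunc.X)⁻¹)) := by
  classical
  obtain ⟨c, hcS, hc⟩ := hGor
  obtain ⟨G', g, hg0, hCg⟩ := exists_lattice_generators G
  rw [← hpoly] at hCg
  have hmem : ∀ x : Fin n → ℤ, x ∈ S ↔ (fun i => (x i : ℝ)) ∈ C := fun x => by rw [hSdef]; rfl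
  have hC0 : (0 : Fin n → ℝ) ∈ C := by
    have h0 : (0 : Fin n → ℝ) ∈ C ∩ -C := by rw [hpointed]; rfl
    exact h0.1
  have hS0 : (0 : Fin n → ℤ) ∈ S := by
    rw [hmem]
    convert hC0
    simp
  let S' : AddSubmonoid (Fin n → ℤ) :=
    { carrier := S
      zero_mem' := hS0
      add_mem' := by
        intro a b ha hb
        rw [hmem, hCg] at ha hb ⊢
        convert add_mem_coneOf ha hb
        simp }
  have hint : (interior C).Nonempty := by
    have h : c + 0 ∈ {x : Fin n → ℤ | (fun i => (x i : ℝ)) ∈ interior C} := by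
      rw [hc]; exact ⟨0, hS0, rfl⟩
    exact ⟨_, h⟩
  have hpt : ∀ x ∈ C, -x ∈ C → x = 0 := by
    intro x hx hx'
    have : x ∈ C ∩ -C := ⟨hx, hx'⟩
    rwa [hpointed] at this
  obtain ⟨p, p', q, hq, hp, hp', e⟩ := isReciprocal_interior_coneOf hg0 hCg hpt hint hfull
    (S := S') hmem hadd hzero hfin
  rw [Fintype.card_fin] at e
  change hilbertSeries deg S * _ = _ at hp
  rw [hc, hilbertSeries_image_add fun a ha => hadd c hcS a ha, mul_assoc, hp] at hp'
  have hpp : p' = Polynomial.X ^ deg c * p := by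
    apply Polynomial.coe_injective
    rw [← hp']
    simp
  refine ⟨p, q, -(deg c : ℤ), hq, hp, ?_⟩
  rw [hpp, map_mul, map_pow, RatFunc.algebraMap_X, mul_div_assoc] at e
  have hX : (RatFunc.X : RatFunc ℚ) ≠ 0 := RatFunc.X_ne_zero
  rw [mul_right_comm, ← e, zpow_neg, zpow_natCast, mul_comm, ← mul_assoc,
    inv_mul_cancel₀ (pow_ne_zero _ hX), one_mul]
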